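/- arXiv:2103.01678 — 2 statements merged into one kernel-verified Lean document; each statement's English description precedes it below -/
import Mathlib

section
/- Let X = {x_1, …, x_n} ⊆ ℝ^d be a finite data set with empirical measure ρ = (1/n) Σ_{i=1}^n δ_{x_i}. Let k ≥ 1 and let Ŝ ⊆ ℝ^d with |Ŝ| = k be a geometric k-medians set for X, i.e. a minimizer of S ↦ Σ_{x∈X} d(x,S) over all subsets S ⊆ ℝ^d of cardinality k, where d(x,S) = min_{s∈S} ‖x−s‖. Let π_Ŝ be a measurable nearest-point projection onto Ŝ. Then the pushforward measure π_Ŝ♯ρ minimizes the Wasserstein-1 distance to ρ among all probability measures supported on at most k points: for every Borel probability measure μ on ℝ^d whose support has cardinality at most k, W_1(ρ, μ) ≥ W_1(ρ, π_Ŝ♯ρ). -/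
open MeasureTheory ENNReal

/-- The Wasserstein-1 distance (with respect to the Euclidean norm) between two Borel
probability measures on `ℝ^d`, defined via the infimum over all couplings of the expected
distance. -/
noncomputable def W1 {d : ℕ}
    (μ ν : Measure (EuclideanSpace ℝ (Fin d))) : ℝ≥0∞ :=
  ⨅ γ ∈ {γ : Measure (EuclideanSpace ℝ (Fin d) × EuclideanSpace ℝ (Fin d)) |
      γ.map Prod.fst = μ ∧ γ.map Prod.snd = ν},
    ∫⁻ z, edist z.1 z.2 ∂γ

/-- Transporting `ρ` along a measurable map bounds the Wasserstein-1 distance to its pushforward. -/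
theorem W1_map_le_lintegral_edist {d : ℕ} (ρ : Measure (EuclideanSpace ℝ (Fin d)))
    {f : EuclideanSpace ℝ (Fin d) → EuclideanSpace ℝ (Fin d)} (hf : Measurable f) :
    W1 ρ (ρ.map f) ≤ ∫⁻ z, edist z (f z) ∂ρ := by
  have hg : Measurable fun z => (z, f z) := measurable_id.prodMk hf
  refine (iInf₂_le (ρ.map fun z => (z, f z)) ⟨?_, ?_⟩).trans_eq
    (lintegral_map measurable_edist hg)
  · rw [Measure.map_map measurable_fst hg]
    exact Measure.map_id
  · rw [Measure.map_map measurable_snd hg]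
    rfl

/-- If `μ` is concentrated on `T`, then `W1 ρ μ` is at least the average distance to any
superset of `T`. -/
theorem lintegral_infEDist_le_W1 {d : ℕ} (ρ μ : Measure (EuclideanSpace ℝ (Fin d)))
    {S T : Set (EuclideanSpace ℝ (Fin d))} (hTS : T ⊆ S) (hμ : μ Tᶜ = 0) :
    ∫⁻ z, Metric.infEDist z S ∂ρ ≤ W1 ρ μ := by
  refine le_iInf₂ fun γ ⟨h₁, h₂⟩ => ?_
  rw [← h₁, lintegral_map measurable_infEDist measurable_fst]
  have hT : ∀ᵐ z ∂γ.map Prod.snd, z ∈ T := by rwa [h₂]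
  refine lintegral_mono_ae ?_
  filter_upwards [ae_of_ae_map measurable_snd.aemeasurable hT] with z hz
  exact Metric.infEDist_le_edist_of_mem (hTS hz)

/-- Integration against an empirical measure is averaging over its points. -/
theorem lintegral_empirical {E : Type*} [MeasurableSpace E] {n : ℕ} (x : Fin n → E)
    {f : E → ℝ≥0∞} (hf : Measurable f) :
    ∫⁻ z, f z ∂((n : ℝ≥0∞)⁻¹ • ∑ i, Measure.dirac (x i)) = (n : ℝ≥0∞)⁻¹ * ∑ i, f (x i) := by
  simp [lintegral_smul_measure, lintegral_finsetSum_measure, lintegral_dirac' _ hf]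

/-- Let `X = {x 1, …, x n} ⊆ ℝ^d` with empirical measure `ρ = (1/n) ∑ δ_{x i}`. If `Ŝ` is a
geometric `k`-medians set for `X` (a minimizer of `S ↦ ∑ i, d(x i, S)` over sets of
cardinality `k`) and `π` is a measurable nearest-point projection onto `Ŝ`, then the
pushforward `π♯ρ` minimizes the `W₁` distance to `ρ` among all probability measures
supported on at most `k` points. -/
theorem geometric_k_medians_minimizes_W1
    {d n k : ℕ} (hn : 1 ≤ n) (hk : 1 ≤ k) (x : Fin n → EuclideanSpace ℝ (Fin d))
    (Shat : Set (EuclideanSpace ℝ (Fin d))) (hcard : Shat.ncard = k)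
    (hmin : ∀ S' : Set (EuclideanSpace ℝ (Fin d)), S'.ncard = k →
      ∑ i, EMetric.infEdist (x i) Shat ≤ ∑ i, EMetric.infEdist (x i) S')
    (π : EuclideanSpace ℝ (Fin d) → EuclideanSpace ℝ (Fin d)) (hπmeas : Measurable π)
    (hπmem : ∀ z, π z ∈ Shat) (hπnear : ∀ z, ∀ s ∈ Shat, dist z (π z) ≤ dist z s)
    (μ : Measure (EuclideanSpace ℝ (Fin d))) [IsProbabilityMeasure μ]
    (hμsupp : ∃ T : Set (EuclideanSpace ℝ (Fin d)), T.Finite ∧ T.ncard ≤ k ∧ μ Tᶜ = 0) :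
    W1 ((n : ℝ≥0∞)⁻¹ • ∑ i, Measure.dirac (x i))
        (((n : ℝ≥0∞)⁻¹ • ∑ i, Measure.dirac (x i)).map π)
      ≤ W1 ((n : ℝ≥0∞)⁻¹ • ∑ i, Measure.dirac (x i)) μ := by
  obtain ⟨T, hTfin, hTcard, hT⟩ := hμsupp
  have hSfin : Shat.Finite := Set.finite_of_ncard_pos (by lia)
  obtain ⟨S, hTS, -, hScard⟩ := Set.exists_subsuperset_card_eq
    (Set.subset_union_right (s := Shat) (t := T)) hTcard
    (hcard ▸ Set.ncard_le_ncard Set.subset_union_left (hSfin.union hTfin))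
  refine (W1_map_le_lintegral_edist _ hπmeas).trans
    (le_trans ?_ (lintegral_infEDist_le_W1 _ μ hTS hT))
  rw [lintegral_empirical x (f := fun z => edist z (π z)) (measurable_id.edist hπmeas),
    lintegral_empirical x measurable_infEDist]
  refine mul_le_mul_right ?_ _
  refine (Finset.sum_le_sum fun i _ => ?_).trans (hmin S hScard)
  refine Metric.le_infEDist.2 fun s hs => ?_
  simpa only [edist_dist] using ENNReal.ofReal_le_ofReal (hπnear (x i) s hs)
end

section
/- (Non-vanishing minimax bias of the sample Wasserstein gradient for Bernoulli measures.) For every integer n ≥ 1 there exist parameters θ*, θ ∈ (0,1) with θ ∉ {k/n : k = 0,…,n} such that, if X_1, …, X_n are i.i.d. Bernoulli(θ*) random variables and θ̂ = (1/n) Σ_{i=1}^n X_i, then | 𝔼[ sgn(θ − θ̂) ] − sgn(θ − θ*) | ≥ 2 e^{−2}, where sgn(t) = 1 for t > 0, sgn(t) = −1 for t < 0, and sgn(0) = 0. Here sgn(θ − θ̂) is the derivative in θ of the sample Wasserstein loss W_1(p_n^*, Ber(θ)) = |θ − θ̂| (defined almost surely since θ ≠ k/n), and sgn(θ − θ*)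 is the derivative in θ of the true Wasserstein loss W_1(Ber(θ*), Ber(θ)) = |θ − θ*|. -/
open MeasureTheory ENNReal NNReal

/-- The Bernoulli measure `Ber(a) = (1 − a)·δ₀ + a·δ₁` with parameter `a ∈ [0, 1]`, viewed
as a probability measure on `ℝ`. -/
noncomputable def Ber (a : ℝ) : Measure ℝ :=
  (1 - a).toNNReal • Measure.dirac (0 : ℝ) + a.toNNReal • Measure.dirac (1 : ℝ)

instance (a : ℝ) : IsFiniteMeasure (Ber a) := by
  unfold Ber; infer_instance

theorem isProbabilityMeasure_Ber {a : ℝ} (h₀ : 0 ≤ a) (h₁ : a ≤ 1) :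
    IsProbabilityMeasure (Ber a) := by
  constructor
  simp only [Ber, Measure.coe_add, Measure.coe_nnreal_smul_apply, Pi.add_apply, measure_univ,
    mul_one]
  rw [← ENNReal.coe_add, ← Real.toNNReal_add (by linarith) h₀]
  simp

theorem Ber_singleton_zero (a : ℝ) : Ber a {0} = ENNReal.ofReal (1 - a) := by
  simp [Ber, ENNReal.ofReal]

theorem Real.measurable_sign : Measurable Real.sign :=
  Measurable.ite measurableSet_Iio measurable_const
    (Measurable.ite measurableSet_Ioi measurable_const measurable_const)

theorem Real.abs_sign_le_one (x : ℝ) : |Real.sign x| ≤ 1 := by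
  rcases Real.sign_apply_eq x with h | h | h <;> simp [h]

/-- If `0 < θ`, the event that all samples vanish contributes to `θ̂ < θ`, which bounds the
expected sample gradient from below. -/
theorem integral_sign_sub_mean_ge {n : ℕ} {a θ : ℝ} (h₀ : 0 ≤ a) (h₁ : a ≤ 1) (hθ : 0 < θ) :
    2 * (1 - a) ^ n - 1 ≤ ∫ ω : Fin n → ℝ, Real.sign (θ - (1 / (n : ℝ)) * ∑ i, ω i)
      ∂(Measure.pi fun _ : Fin n => Ber a) := by
  have := isProbabilityMeasure_Ber h₀ h₁
  set μ := Measure.pi fun _ : Fin n => Ber a with hμ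
  have hint : Integrable
      (fun ω : Fin n → ℝ => Real.sign (θ - (1 / (n : ℝ)) * ∑ i, ω i)) μ := by
    refine Integrable.of_bound (C := 1) ?_ (ae_of_all _ fun ω => Real.abs_sign_le_one _)
    exact (Real.measurable_sign.comp (by fun_prop)).aestronglyMeasurable
  have hind : Integrable (({0} : Set (Fin n → ℝ)).indicator fun _ => (2 : ℝ)) μ :=
    (integrable_const _).indicator (measurableSet_singleton _)
  have hzero : μ.real {0} = (1 - a) ^ n := by
    rw [measureReal_def, hμ, Measure.pi_singleton]
    simp [Ber_singleton_zero, h₁]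
  calc 2 * (1 - a) ^ n - 1
      = ∫ ω, (({0} : Set (Fin n → ℝ)).indicator (fun _ => (2 : ℝ)) ω - 1) ∂μ := by
        rw [integral_sub hind (integrable_const _),
          integral_indicator_const _ (measurableSet_singleton _), hzero]
        simp [mul_comm]
    _ ≤ _ := by
        refine integral_mono (hind.sub (integrable_const _)) hint fun ω => ?_
        by_cases hω : ω = 0
        · simp [hω, Real.sign_of_pos hθ]
          norm_num
        · simpa [hω] using (abs_le.mp (Real.abs_sign_le_one _)).1

/-- Non-vanishing minimax bias of the sample Wasserstein gradient for Bernoulli measures: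
for every `n ≥ 1` there are parameters `θ*, θ ∈ (0,1)` with `θ ∉ {k/n}` such that, with
`X₁, …, Xₙ` i.i.d. `Bernoulli(θ*)` (modelled by the product measure `(Ber θ*)^⊗n`) and
`θ̂ = (1/n) ∑ Xᵢ`, one has `|𝔼[sgn(θ − θ̂)] − sgn(θ − θ*)| ≥ 2 e⁻²`. Here `sgn(θ − θ̂)` is
the θ-derivative of the sample Wasserstein loss `W₁(pₙ*, Ber θ) = |θ − θ̂|` and
`sgn(θ − θ*)` is the θ-derivative of the true Wasserstein loss `W₁(Ber θ*, Ber θ)`. -/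
theorem bernoulli_sample_gradient_bias :
    ∀ n : ℕ, 1 ≤ n → ∃ θstar θ : ℝ,
      θstar ∈ Set.Ioo (0 : ℝ) 1 ∧ θ ∈ Set.Ioo (0 : ℝ) 1 ∧
      (∀ k : ℕ, k ≤ n → θ ≠ (k : ℝ) / (n : ℝ)) ∧
      |(∫ ω : Fin n → ℝ,
            Real.sign (θ - (1 / (n : ℝ)) * ∑ i, ω i)
          ∂(Measure.pi fun _ : Fin n => Ber θstar))
        - Real.sign (θ - θstar)| ≥ 2 * Real.exp (-2) := by
  intro n hn
  have hn' : (1 : ℝ) ≤ n := by exact_mod_cast hn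
  have hn₀ : (0 : ℝ) < n := by linarith
  have hlt : 1 / (4 * n : ℝ) < 1 / (2 * n) := by gcongr; norm_num
  have hpos : 0 < 1 / (4 * n : ℝ) := by positivity
  have hhalf : 1 / (2 * n : ℝ) ≤ 1 / 2 := by gcongr; linarith
  refine ⟨1 / (2 * n), 1 / (4 * n), ⟨by linarith, by linarith⟩, ⟨hpos, by linarith⟩, ?_, ?_⟩
  · intro k _ h
    field_simp at h
    norm_cast at h
    omega
  · rw [Real.sign_of_neg (sub_neg.mpr hlt)]
    refine le_trans ?_ (le_abs_self _)
    have hE := integral_sign_sub_mean_ge (n := n) (hpos.trans hlt).le (by linarith) hpos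
    have hpow : 1 / 2 ≤ (1 - 1 / (2 * n : ℝ)) ^ n := by
      have h := one_add_mul_le_pow (a := -(1 / (2 * n : ℝ))) (by linarith) n
      rw [← sub_eq_add_neg] at h
      refine le_trans (le_of_eq ?_) h
      field_simp
      norm_num
    have hexp : Real.exp (-2) ≤ 1 / 2 := by
      rw [Real.exp_neg, one_div]
      gcongr
      linarith [Real.add_one_le_exp 2]
    linarith
end
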